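/- Let a, b, x be positive real numbers, let w = arcosh((cosh x + cosh a · cosh b)/(sinh a · sinh b)), and let h = arcosh(sinh b · sinh w) (the argument sinh b · sinh w is greater than 1). Then h ≤ 1/a + (1/2)·(1/b + 1/x) + b + x + 2·log 2. -/

import Mathlib

noncomputable def arcosh (x : ℝ) : ℝ := Real.log (x + Real.sqrt (x ^ 2 - 1))

noncomputable def coth (x : ℝ) : ℝ := Real.cosh x / Real.sinh x

theorem stmt_2 (a b x : ℝ) (ha : 0 < a) (hb : 0 < b) (hx : 0 < x)
    (w h : ℝ)
    (hw : w = arcosh ((Real.cosh x + Real.cosh a * Real.cosh b) / (Real.sinh a * Real.sinh b)))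
    (hh : h = arcosh (Real.sinh b * Real.sinh w)) :
    h ≤ 1 / a + (1 / 2) * (1 / b + 1 / x) + b + x + 2 * Real.log 2 := by
  have hsa : 0 < Real.sinh a := Real.sinh_pos_iff.2 ha
  have hsb : 0 < Real.sinh b := Real.sinh_pos_iff.2 hb
  have haa : a ≤ Real.sinh a := Real.self_le_sinh_iff.2 ha.le
  have hC1 : 1 < (Real.cosh x + Real.cosh a * Real.cosh b) / (Real.sinh a * Real.sinh b) := by
    rw [lt_div_iff₀ (by positivity), one_mul]
    have := Real.one_le_cosh x
    have h1 := Real.sinh_lt_cosh a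
    have h2 := Real.sinh_lt_cosh b
    have := mul_lt_mul'' h1 h2 hsa.le hsb.le
    linarith
  have hw' : w = Real.arcosh ((Real.cosh x + Real.cosh a * Real.cosh b) /
      (Real.sinh a * Real.sinh b)) := hw
  have hw0 : 0 < w := by rw [hw']; exact Real.arcosh_pos hC1
  have hcw : Real.cosh w = (Real.cosh x + Real.cosh a * Real.cosh b) /
      (Real.sinh a * Real.sinh b) := by rw [hw']; exact Real.cosh_arcosh hC1.le
  have hsw : 0 < Real.sinh w := Real.sinh_pos_iff.2 hw0
  have hS0 : 0 < Real.sinh b * Real.sinh w := by positivity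
  have hexp : ∀ t : ℝ, 0 < t → Real.cosh t ≤ Real.exp t := fun t ht => by
    have := Real.cosh_add_sinh t
    have := Real.sinh_pos_iff.2 ht
    linarith
  have hS : Real.sinh b * Real.sinh w ≤
      (Real.cosh x + Real.cosh a * Real.cosh b) / Real.sinh a := by
    have h1 : Real.sinh b * Real.sinh w ≤ Real.sinh b * Real.cosh w :=
      mul_le_mul_of_nonneg_left (Real.sinh_lt_cosh w).le hsb.le
    refine h1.trans (le_of_eq ?_)
    rw [hcw]; field_simp
  have hca : Real.cosh a ≤ Real.sinh a + 1 := by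
    have := Real.cosh_sub_sinh a
    have : Real.exp (-a) ≤ 1 := Real.exp_le_one_iff.2 (by linarith)
    linarith
  have hinv : 1 / Real.sinh a ≤ 1 / a := one_div_le_one_div_of_le ha haa
  have hcoth : Real.cosh a / Real.sinh a ≤ 1 + 1 / a := by
    have : Real.cosh a / Real.sinh a ≤ (Real.sinh a + 1) / Real.sinh a := by gcongr
    rw [add_div, div_self hsa.ne'] at this
    linarith
  have hex : Real.exp x ≤ Real.exp (b + x) := Real.exp_le_exp.2 (by linarith)
  have heb : Real.exp b ≤ Real.exp (b + x) := Real.exp_le_exp.2 (by linarith)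
  have hS2 : Real.sinh b * Real.sinh w ≤ 2 * Real.exp (1 / a + b + x) := by
    calc _ ≤ _ := hS
      _ = (1 / Real.sinh a) * Real.cosh x + (Real.cosh a / Real.sinh a) * Real.cosh b := by ring
      _ ≤ (1 / a) * Real.exp (b + x) + (1 + 1 / a) * Real.exp (b + x) := by
        have := Real.cosh_pos x
        have := Real.cosh_pos b
        have := (hexp x hx).trans hex
        have := (hexp b hb).trans heb
        gcongr
      _ = 2 * ((1 / a + 1 / 2) * Real.exp (b + x)) := by ring
      _ ≤ 2 * (Real.exp (1 / a) * Real.exp (b + x)) := by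
        have := Real.add_one_le_exp (1 / a)
        gcongr
        linarith
      _ = _ := by rw [← Real.exp_add]; ring_nf
  have hsq : Real.sqrt ((Real.sinh b * Real.sinh w) ^ 2 - 1) ≤ Real.sinh b * Real.sinh w :=
    Real.sqrt_le_iff.2 ⟨hS0.le, by linarith⟩
  have hlog : h ≤ Real.log (2 * 2 * Real.exp (1 / a + b + x)) := by
    rw [hh]
    unfold arcosh
    apply Real.log_le_log
    · have := Real.sqrt_nonneg ((Real.sinh b * Real.sinh w) ^ 2 - 1)
      linarith
    · linarith
  rw [Real.log_mul (by norm_num) (Real.exp_pos _).ne', Real.log_exp,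
    Real.log_mul (by norm_num) (by norm_num)] at hlog
  have : 0 < 1 / b := by positivity
  have : 0 < 1 / x := by positivity
  linarith
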